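/- Let u* be the ground state of the Gross–Pitaevskii eigenvalue problem and let C_u > 0. There exists a constant L_g, depending only on Ω, d, β, V, u*, and ‖u₀‖_{H^1_0(Ω)}, such that ‖∇^R_{a_u}E(u)‖_{a_{u*}(Ω)} ≤ L_g·‖u − u*‖_{a_{u*}(Ω)} holds for every u ∈ M with ‖u‖_{H^1_0(Ω)} ≤ C_u and ‖u − u*‖_{a_{u*}(Ω)} sufficiently small. -/

import Mathlib

open scoped RealInnerProductSpace
open Filter Topology

/-- Abstract setting for the Gross–Pitaevskii eigenvalue problem on a bounded
Lipschitz domain `Ω ⊆ ℝᵈ` (`d ∈ {1,2,3}`) with potential `0 ≤ V ≤ Vmax` in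
`L^∞(Ω)` and interaction parameter `β ≥ 0`.

The Hilbert space `H` plays the role of `H¹₀(Ω)` equipped with the inner product
`(z,w)_{H¹₀} = (∇z,∇w)_{L²}`; `P z w` is the `L²(Ω)` inner product `∫ z w`,
`Vf z w = ∫ V z w`, and `Q4 a b c d = ∫ a b c d` (defined on `H` thanks to the
Sobolev embedding `H¹₀ ↪ L⁴` valid for `d ≤ 3`).

`C₁`, `C₂`, `C₃` are, respectively, the constants of the embedding
`‖u‖_{L⁴} ≤ C₁ ‖u‖_{H¹₀}`, of the embedding `‖·‖_{H⁻¹} ≤ C₂ ‖·‖_{L^{4/3}}`,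
and of the Poincaré inequality `‖u‖_{L²} ≤ C₃ ‖u‖_{H¹₀}`.

`G`, `GV`, `Gc` are, respectively, `G_{H¹}`, `u ↦ G_{H¹}(V u)` and
`u ↦ G_{H¹}(|u|² u)`, characterized by their defining Riesz identities
(`Gc_bound` encodes `‖G_{H¹}(|u|²u)‖_{H¹₀} ≤ ‖u³‖_{H⁻¹} ≤ C₂ ‖u³‖_{L^{4/3}}
= C₂ ‖u‖_{L⁴}³`).  `G0`, `G0c` are the analogous Green operators for the
`a₀`-inner product `(z,w)_{a₀} = ∫ ∇z·∇w + V z w`, and `Gau u` is the Green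
operator for the `a_u`-inner product
`(z,w)_{a_u} = ∫ ∇z·∇w + V z w + β|u|² z w`. -/
structure GPSetting (H : Type*) [NormedAddCommGroup H] [InnerProductSpace ℝ H] where
  /-- the `L²(Ω)` inner product `(z,w)_{L²} = ∫ z w` on `H = H¹₀(Ω)` -/
  P : H →ₗ[ℝ] H →ₗ[ℝ] ℝ
  P_symm : ∀ z w : H, P z w = P w z
  P_nonneg : ∀ z : H, 0 ≤ P z z
  P_definite : ∀ z : H, P z z = 0 → z = 0
  /-- `Vmax`, the (essential) upper bound of the potential `V` -/
  Vmax : ℝ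
  Vmax_nonneg : 0 ≤ Vmax
  /-- the bilinear form `Vf z w = ∫ V z w` -/
  Vf : H →ₗ[ℝ] H →ₗ[ℝ] ℝ
  Vf_symm : ∀ z w : H, Vf z w = Vf w z
  Vf_nonneg : ∀ z : H, 0 ≤ Vf z z
  Vf_le : ∀ z : H, Vf z z ≤ Vmax * P z z
  /-- the interaction parameter `β ≥ 0` -/
  β : ℝ
  β_nonneg : 0 ≤ β
  /-- the quadrilinear form `Q4 a b c d = ∫ a b c d` -/
  Q4 : H →ₗ[ℝ] H →ₗ[ℝ] H →ₗ[ℝ] H →ₗ[ℝ] ℝ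
  Q4_symm₁ : ∀ a b c d : H, Q4 a b c d = Q4 b a c d
  Q4_symm₂ : ∀ a b c d : H, Q4 a b c d = Q4 a c b d
  Q4_symm₃ : ∀ a b c d : H, Q4 a b c d = Q4 a b d c
  Q4_sq_nonneg : ∀ z w : H, 0 ≤ Q4 z z w w
  /-- the constant of the Sobolev embedding `‖u‖_{L⁴} ≤ C₁ ‖u‖_{H¹₀}` -/
  C₁ : ℝ
  C₁_pos : 0 < C₁
  embed_L4 : ∀ u : H, Q4 u u u u ≤ C₁ ^ 4 * ‖u‖ ^ 4
  /-- the constant of the embedding `‖·‖_{H⁻¹} ≤ C₂ ‖·‖_{L^{4/3}}` -/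
  C₂ : ℝ
  C₂_pos : 0 < C₂
  /-- the Poincaré constant: `‖u‖_{L²} ≤ C₃ ‖u‖_{H¹₀}` -/
  C₃ : ℝ
  C₃_pos : 0 < C₃
  poincare : ∀ u : H, P u u ≤ C₃ ^ 2 * ‖u‖ ^ 2
  /-- the Green operator `G_{H¹}`: `(z, G_{H¹} w)_{H¹₀} = (z,w)_{L²}` -/
  G : H →ₗ[ℝ] H
  G_def : ∀ z w : H, ⟪z, G w⟫ = P z w
  /-- `GV w = G_{H¹}(V w)`: `(z, G_{H¹}(Vw))_{H¹₀} = ∫ V z w` -/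
  GV : H →ₗ[ℝ] H
  GV_def : ∀ z w : H, ⟪z, GV w⟫ = Vf z w
  /-- `Gc w = G_{H¹}(|w|² w)`: `(z, G_{H¹}(w³))_{H¹₀} = ∫ z w³` -/
  Gc : H → H
  Gc_def : ∀ z w : H, ⟪z, Gc w⟫ = Q4 z w w w
  Gc_bound : ∀ w : H, ‖Gc w‖ ≤ C₂ * (Q4 w w w w) ^ ((3 : ℝ) / 4)
  /-- the Green operator `G_{a₀}`: `(z, G_{a₀} w)_{a₀} = (z,w)_{L²}` -/
  G0 : H →ₗ[ℝ] H
  G0_def : ∀ z w : H, ⟪z, G0 w⟫ + Vf z (G0 w) = P z w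
  /-- `G0c w = G_{a₀}(|w|² w)` -/
  G0c : H → H
  G0c_def : ∀ z w : H, ⟪z, G0c w⟫ + Vf z (G0c w) = Q4 z w w w
  /-- the Green operator `G_{a_u}`: `(z, G_{a_u} w)_{a_u} = (z,w)_{L²}` -/
  Gau : H → H → H
  Gau_def : ∀ u z w : H,
    ⟪z, Gau u w⟫ + Vf z (Gau u w) + β * Q4 u u z (Gau u w) = P z w

namespace GPSetting

variable {H : Type*} [NormedAddCommGroup H] [InnerProductSpace ℝ H] (S : GPSetting H)

/-- the `L²(Ω)` norm -/
noncomputable def l2norm (u : H) : ℝ := Real.sqrt (S.P u u)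

/-- the `L⁴(Ω)` norm -/
noncomputable def l4norm (u : H) : ℝ := (S.Q4 u u u u) ^ ((1 : ℝ) / 4)

/-- the `H⁻¹(Ω)` (dual) norm of an element of `H¹₀(Ω)` -/
noncomputable def HnegNorm (u : H) : ℝ := ⨆ z : {z : H // ‖z‖ ≤ 1}, S.P z.1 u

/-- the manifold `M = {u ∈ H¹₀(Ω) : ‖u‖_{L²} = 1}` -/
def Msphere : Set H := {u : H | S.P u u = 1}

/-- the Gross–Pitaevskii energy
`E(u) = ∫ (1/2)|∇u|² + (1/2)V|u|² + (β/4)|u|⁴` -/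
noncomputable def energy (u : H) : ℝ :=
  (1 / 2) * ‖u‖ ^ 2 + (1 / 2) * S.Vf u u + (S.β / 4) * S.Q4 u u u u

/-- the retraction `R(u) = u / ‖u‖_{L²}` -/
noncomputable def retract (u : H) : H := (S.l2norm u)⁻¹ • u

/-- the `H¹`-gradient `∇_{H¹}E(u) = u + G_{H¹}(Vu + β|u|²u)` -/
noncomputable def gradH1 (u : H) : H := u + S.GV u + S.β • S.Gc u

/-- the Riemannian `H¹`-gradient
`∇^R_{H¹}E(u) = ∇_{H¹}E(u) − ((∇_{H¹}E(u),u)_{L²}/‖G_{H¹}u‖²_{H¹₀}) G_{H¹}u` -/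
noncomputable def gradRH1 (u : H) : H :=
  S.gradH1 u - (S.P (S.gradH1 u) u / ‖S.G u‖ ^ 2) • S.G u

/-- the `a₀`-inner product `(z,w)_{a₀} = ∫ ∇z·∇w + Vzw` -/
noncomputable def a0inner (z w : H) : ℝ := ⟪z, w⟫ + S.Vf z w

/-- the `a₀`-norm -/
noncomputable def a0norm (z : H) : ℝ := Real.sqrt (S.a0inner z z)

/-- the `a₀`-gradient `∇_{a₀}E(u) = u + β G_{a₀}(|u|²u)` -/
noncomputable def gradA0 (u : H) : H := u + S.β • S.G0c u

/-- the Riemannian `a₀`-gradient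
`∇^R_{a₀}E(u) = ∇_{a₀}E(u) − ((∇_{a₀}E(u),u)_{L²}/‖G_{a₀}u‖²_{a₀}) G_{a₀}u` -/
noncomputable def gradRA0 (u : H) : H :=
  S.gradA0 u - (S.P (S.gradA0 u) u / (S.a0norm (S.G0 u)) ^ 2) • S.G0 u

/-- the `a_u`-inner product `(z,w)_{a_u} = ∫ ∇z·∇w + Vzw + β|u|²zw` -/
noncomputable def auinner (u z w : H) : ℝ :=
  ⟪z, w⟫ + S.Vf z w + S.β * S.Q4 u u z w

/-- the `a_u`-norm -/
noncomputable def aunorm (u z : H) : ℝ := Real.sqrt (S.auinner u z z)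

/-- the Riemannian `a_u`-gradient
`∇^R_{a_u}E(u) = u − G_{a_u}u / ‖G_{a_u}u‖²_{a_u}` -/
noncomputable def gradRAu (u : H) : H :=
  u - ((S.aunorm u (S.Gau u u)) ^ 2)⁻¹ • S.Gau u u

/-- `ustar` is the ground state: the minimizer of `E` over `M`. -/
def IsGroundState (ustar : H) : Prop :=
  ustar ∈ S.Msphere ∧ ∀ u ∈ S.Msphere, S.energy ustar ≤ S.energy u

/-- `lam0` and `lam1` are the smallest and second smallest eigenvalues of the
linearized problem `(−Δ + V + β|u*|²)u = λu` at the ground state `u*` (whose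
bilinear form is the `a_{u*}`-inner product): `u*` is an eigenfunction for
`lam0`, `lam0` is a lower bound for the Rayleigh quotient, and `lam1` is a lower
bound for the Rayleigh quotient on the `L²`-orthogonal complement of `u*`. -/
def LinearizedEigs (ustar : H) (lam0 lam1 : ℝ) : Prop :=
  (∀ z : H, S.auinner ustar z ustar = lam0 * S.P z ustar) ∧
  (∀ z : H, lam0 * S.P z z ≤ S.auinner ustar z z) ∧
  (∀ z : H, S.P z ustar = 0 → lam1 * S.P z z ≤ S.auinner ustar z z)

end GPSetting

namespace GPSetting

/-- Cauchy–Schwarz in quantitative form: a symmetric positive semidefinite bilinear form with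
quadratic growth constant `K` is bounded by `K`. -/
theorem abs_apply_le_of_diag_le {H : Type*} [NormedAddCommGroup H] [InnerProductSpace ℝ H]
    (B : H →ₗ[ℝ] H →ₗ[ℝ] ℝ) (hs : ∀ z w, B z w = B w z) (hn : ∀ z, 0 ≤ B z z)
    {K : ℝ} (hK : 0 ≤ K) (hB : ∀ z, B z z ≤ K * ‖z‖ ^ 2) (z w : H) :
    |B z w| ≤ K * ‖z‖ * ‖w‖ := by
  have hcs : B z w ^ 2 ≤ B z z * B w w := by
    have h : discrim (B z z) (2 * B z w) (B w w) ≤ 0 := by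
      refine discrim_le_zero fun t => ?_
      have h := hn (t • z + w)
      simp only [map_add, map_smul, LinearMap.add_apply, LinearMap.smul_apply, smul_eq_mul,
        hs w z] at h
      linarith
    unfold discrim at h
    linarith
  refine abs_le_of_sq_le_sq ?_ (by positivity)
  calc B z w ^ 2 ≤ B z z * B w w := hcs
    _ ≤ (K * ‖z‖ ^ 2) * (K * ‖w‖ ^ 2) :=
        mul_le_mul (hB z) (hB w) (hn w) (by positivity)
    _ = (K * ‖z‖ * ‖w‖) ^ 2 := by ring

variable {H : Type*} [NormedAddCommGroup H] [InnerProductSpace ℝ H] (S : GPSetting H)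

theorem abs_P_le (z w : H) : |S.P z w| ≤ S.C₃ ^ 2 * ‖z‖ * ‖w‖ :=
  abs_apply_le_of_diag_le S.P S.P_symm S.P_nonneg (by positivity) S.poincare z w

theorem abs_Vf_le (z w : H) : |S.Vf z w| ≤ S.Vmax * S.C₃ ^ 2 * ‖z‖ * ‖w‖ := by
  have hV := S.Vmax_nonneg
  refine abs_apply_le_of_diag_le S.Vf S.Vf_symm S.Vf_nonneg (by positivity) (fun x => ?_) z w
  calc S.Vf x x ≤ S.Vmax * S.P x x := S.Vf_le x
    _ ≤ S.Vmax * (S.C₃ ^ 2 * ‖x‖ ^ 2) := by gcongr; exact S.poincare x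
    _ = S.Vmax * S.C₃ ^ 2 * ‖x‖ ^ 2 := by ring

theorem Q4_add_diag (a b : H) :
    S.Q4 (a + b) (a + b) (a + b) (a + b) = S.Q4 a a a a + 4 * S.Q4 a a a b
      + 6 * S.Q4 a a b b + 4 * S.Q4 a b b b + S.Q4 b b b b := by
  simp only [map_add, LinearMap.add_apply, S.Q4_symm₁ b a, fun x => S.Q4_symm₂ x b a,
    fun x y => S.Q4_symm₃ x y b a]
  ring

theorem Q4_add_cube (a b c : H) :
    S.Q4 (a + b) (a + b) c (a + b) = S.Q4 a a a c + 3 * S.Q4 a a b c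
      + 3 * S.Q4 b b a c + S.Q4 b b b c := by
  simp only [map_add, LinearMap.add_apply, S.Q4_symm₁ b a, fun x => S.Q4_symm₂ x b a,
    fun x y => S.Q4_symm₃ x y c a, fun x y => S.Q4_symm₃ x y c b]
  ring

theorem Q4_sq_sq_le (a b : H) : S.Q4 a a b b ≤ 2 * S.C₁ ^ 4 * ‖a‖ ^ 2 * ‖b‖ ^ 2 := by
  rcases eq_or_ne a 0 with rfl | ha
  · simp
  rcases eq_or_ne b 0 with rfl | hb
  · simp
  have ha' : 0 < ‖a‖ := norm_pos_iff.mpr ha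
  have hb' : 0 < ‖b‖ := norm_pos_iff.mpr hb
  have key : ∀ x y : H, 12 * S.Q4 x x y y ≤
      S.C₁ ^ 4 * (2 * (‖x‖ ^ 2 + ‖y‖ ^ 2)) ^ 2 := by
    intro x y
    have h1 := S.Q4_add_diag x y
    have h2 := S.Q4_add_diag x ((-1 : ℝ) • y)
    have h3 : S.Q4 (x + -y) (x + -y) (x + -y) (x + -y) = S.Q4 x x x x - 4 * S.Q4 x x x y
        + 6 * S.Q4 x x y y - 4 * S.Q4 x y y y + S.Q4 y y y y := by
      rw [← neg_one_smul ℝ y, h2]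
      simp only [map_smul, LinearMap.smul_apply, smul_eq_mul]
      ring
    have e1 := S.embed_L4 (x + y)
    have e2 := S.embed_L4 (x + -y)
    have n1 := S.Q4_sq_nonneg x x
    have n2 := S.Q4_sq_nonneg y y
    have hp : ‖x + y‖ ^ 2 + ‖x + -y‖ ^ 2 = 2 * (‖x‖ ^ 2 + ‖y‖ ^ 2) := by
      have := parallelogram_law_with_norm ℝ x y
      rw [← sub_eq_add_neg]
      nlinarith
    have h4 : ‖x + y‖ ^ 4 + ‖x + -y‖ ^ 4 ≤ (2 * (‖x‖ ^ 2 + ‖y‖ ^ 2)) ^ 2 := by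
      rw [← hp]
      nlinarith [mul_nonneg (sq_nonneg ‖x + y‖) (sq_nonneg ‖x + -y‖)]
    have h5 := mul_le_mul_of_nonneg_left h4 (show 0 ≤ S.C₁ ^ 4 by positivity)
    linarith
  have h := key (‖b‖ • a) (‖a‖ • b)
  simp only [map_smul, LinearMap.smul_apply, smul_eq_mul, norm_smul, norm_norm] at h
  have hC : 0 ≤ S.C₁ ^ 4 * (‖a‖ ^ 2 * ‖b‖ ^ 2) := by positivity
  refine le_of_mul_le_mul_left (a := 12 * (‖a‖ ^ 2 * ‖b‖ ^ 2)) ?_ (by positivity)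
  have hC' := mul_nonneg hC (show 0 ≤ ‖a‖ ^ 2 * ‖b‖ ^ 2 by positivity)
  linarith

theorem abs_Q4_le (a z w : H) :
    |S.Q4 a a z w| ≤ 2 * S.C₁ ^ 4 * ‖a‖ ^ 2 * ‖z‖ * ‖w‖ :=
  abs_apply_le_of_diag_le (S.Q4 a a) (S.Q4_symm₃ a a) (S.Q4_sq_nonneg a)
    (by positivity) (S.Q4_sq_sq_le a) z w

theorem sq_norm_le_auinner (u z : H) : ‖z‖ ^ 2 ≤ S.auinner u z z := by
  have h1 := S.Vf_nonneg z
  have h2 := mul_nonneg S.β_nonneg (S.Q4_sq_nonneg u z)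
  rw [auinner, real_inner_self_eq_norm_sq]
  linarith

theorem aunorm_sq (u z : H) : S.aunorm u z ^ 2 = S.auinner u z z :=
  Real.sq_sqrt ((sq_nonneg _).trans (S.sq_norm_le_auinner u z))

theorem norm_le_aunorm (u z : H) : ‖z‖ ≤ S.aunorm u z :=
  Real.le_sqrt_of_sq_le (S.sq_norm_le_auinner u z)

theorem auinner_self_le (u z : H) : S.auinner u z z ≤
    (1 + S.Vmax * S.C₃ ^ 2 + S.β * (2 * S.C₁ ^ 4 * ‖u‖ ^ 2)) * ‖z‖ ^ 2 := by
  have h1 := (le_abs_self _).trans (S.abs_Vf_le z z)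
  have h2 := mul_le_mul_of_nonneg_left (S.Q4_sq_sq_le u z) S.β_nonneg
  rw [auinner, real_inner_self_eq_norm_sq]
  linarith

theorem aunorm_le (u z : H) : S.aunorm u z ≤
    √(1 + S.Vmax * S.C₃ ^ 2 + S.β * (2 * S.C₁ ^ 4 * ‖u‖ ^ 2)) * ‖z‖ := by
  calc S.aunorm u z
      ≤ √((1 + S.Vmax * S.C₃ ^ 2 + S.β * (2 * S.C₁ ^ 4 * ‖u‖ ^ 2)) * ‖z‖ ^ 2) :=
        Real.sqrt_le_sqrt (S.auinner_self_le u z)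
    _ = _ := by rw [Real.sqrt_mul' _ (sq_nonneg _), Real.sqrt_sq (norm_nonneg z)]

/-- The homogenized form of minimality of the energy on the sphere. -/
theorem IsGroundState.energy_mul_sq_le {S : GPSetting H} {ustar : H}
    (hgs : S.IsGroundState ustar) (v : H) :
    S.energy ustar * S.P v v ^ 2 ≤
      1 / 2 * (‖v‖ ^ 2 + S.Vf v v) * S.P v v + S.β / 4 * S.Q4 v v v v := by
  rcases eq_or_ne v 0 with rfl | hv
  · simp
  have hN : 0 < S.P v v := (S.P_nonneg v).lt_of_ne fun h => hv (S.P_definite v h.symm)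
  have hsq : √(S.P v v) ^ 2 = S.P v v := Real.sq_sqrt hN.le
  have hinv : (√(S.P v v))⁻¹ ^ 2 = (S.P v v)⁻¹ := by rw [inv_pow, hsq]
  generalize (√(S.P v v))⁻¹ = r at hinv
  have hr1 : r ^ 2 * S.P v v = 1 := by rw [hinv]; exact inv_mul_cancel₀ hN.ne'
  have hmem : r • v ∈ S.Msphere := by
    simp only [Msphere, Set.mem_ofPred_eq, map_smul, LinearMap.smul_apply, smul_eq_mul]
    linarith
  have h := hgs.2 _ hmem
  have he : S.energy (r • v) * S.P v v ^ 2 =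
      1 / 2 * (‖v‖ ^ 2 + S.Vf v v) * S.P v v + S.β / 4 * S.Q4 v v v v := by
    simp only [energy, map_smul, LinearMap.smul_apply, smul_eq_mul, norm_smul, mul_pow,
      Real.norm_eq_abs, sq_abs]
    linear_combination (1 / 2 * (‖v‖ ^ 2 + S.Vf v v) * S.P v v
      + S.β / 4 * S.Q4 v v v v * (r ^ 2 * S.P v v + 1)) * hr1
  rw [← he]
  exact mul_le_mul_of_nonneg_right h (sq_nonneg _)

/-- A ground state solves the Gross–Pitaevskii eigenvalue problem. -/
theorem IsGroundState.auinner_eq {S : GPSetting H} {ustar : H}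
    (hgs : S.IsGroundState ustar) (z : H) :
    S.auinner ustar z ustar = S.auinner ustar ustar ustar * S.P z ustar := by
  have h1 : S.P ustar ustar = 1 := hgs.1
  set p : ℝ → ℝ := fun t =>
    1 / 2 * ((‖ustar‖ ^ 2 + S.Vf ustar ustar) + t * (2 * (⟪z, ustar⟫ + S.Vf z ustar))
      + t ^ 2 * (‖z‖ ^ 2 + S.Vf z z)) * (1 + t * (2 * S.P z ustar) + t ^ 2 * S.P z z)
    + S.β / 4 * (S.Q4 ustar ustar ustar ustar + t * (4 * S.Q4 ustar ustar ustar z)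
      + t ^ 2 * (6 * S.Q4 ustar ustar z z) + t ^ 3 * (4 * S.Q4 ustar z z z)
      + t ^ 4 * S.Q4 z z z z)
    - S.energy ustar * (1 + t * (2 * S.P z ustar) + t ^ 2 * S.P z z) ^ 2 with hp
  have hp0 : p 0 = 0 := by
    simp only [hp, energy]
    ring
  have hnonneg : ∀ t, 0 ≤ p t := by
    intro t
    have h := hgs.energy_mul_sq_le (ustar + t • z)
    rw [Q4_add_diag, norm_add_sq_real] at h
    simp only [map_add, LinearMap.add_apply, map_smul, LinearMap.smul_apply, smul_eq_mul,
      inner_smul_right, norm_smul, mul_pow, Real.norm_eq_abs, sq_abs, h1,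
      S.P_symm ustar z, S.Vf_symm ustar z, real_inner_comm z ustar] at h
    simp only [hp]
    linarith
  have hmin : IsLocalMin p 0 := Filter.Eventually.of_forall fun t => by
    rw [hp0]
    exact hnonneg t
  have hd : HasDerivAt p (⟪z, ustar⟫ + S.Vf z ustar
      + (‖ustar‖ ^ 2 + S.Vf ustar ustar) * S.P z ustar
      + S.β * S.Q4 ustar ustar ustar z - 4 * S.energy ustar * S.P z ustar) 0 := by
    have ht := hasDerivAt_id (0 : ℝ)
    have hA := ((ht.mul_const (2 * (⟪z, ustar⟫ + S.Vf z ustar))).const_add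
      (‖ustar‖ ^ 2 + S.Vf ustar ustar)).add ((ht.pow 2).mul_const (‖z‖ ^ 2 + S.Vf z z))
    have hN := ((ht.mul_const (2 * S.P z ustar)).const_add 1).add
      ((ht.pow 2).mul_const (S.P z z))
    have hQ := ((((ht.mul_const (4 * S.Q4 ustar ustar ustar z)).const_add
      (S.Q4 ustar ustar ustar ustar)).add ((ht.pow 2).mul_const (6 * S.Q4 ustar ustar z z))).add
      ((ht.pow 3).mul_const (4 * S.Q4 ustar z z z))).add ((ht.pow 4).mul_const (S.Q4 z z z z))
    refine ((((hA.const_mul (1 / 2)).mul hN).add (hQ.const_mul (S.β / 4))).sub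
      ((hN.pow 2).const_mul (S.energy ustar))).congr_deriv ?_
    simp
    ring
  have h0 := hmin.hasDerivAt_eq_zero hd
  simp only [auinner, energy, real_inner_self_eq_norm_sq, S.Q4_symm₃ ustar ustar z ustar] at h0 ⊢
  linarith

theorem auinner_Gau (u z w : H) : S.auinner u z (S.Gau u w) = S.P z w :=
  S.Gau_def u z w

/-- The Riemannian `a_u`-gradient is tangent to the sphere at `u`. -/
theorem P_gradRAu {u : H} (hu : u ∈ S.Msphere) : S.P (S.gradRAu u) u = 0 := by
  have h1 : S.P u u = 1 := hu
  have hmu : S.aunorm u (S.Gau u u) ^ 2 = S.P (S.Gau u u) u := by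
    rw [aunorm_sq, auinner_Gau]
  have hne : S.P (S.Gau u u) u ≠ 0 := by
    intro h0
    have h := S.sq_norm_le_auinner u (S.Gau u u)
    rw [auinner_Gau, h0] at h
    have hg : S.Gau u u = 0 := by
      rw [← norm_eq_zero]
      exact pow_eq_zero_iff two_ne_zero |>.mp (le_antisymm h (sq_nonneg _))
    have h2 := S.auinner_Gau u u u
    rw [hg, h1] at h2
    simp [auinner] at h2
  rw [gradRAu, hmu]
  simp only [map_sub, LinearMap.sub_apply, map_smul, LinearMap.smul_apply, smul_eq_mul, h1]
  rw [inv_mul_cancel₀ hne, sub_self]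

theorem auinner_gradRAu_self {u : H} (hu : u ∈ S.Msphere) :
    S.auinner u (S.gradRAu u) (S.gradRAu u) = S.auinner u (S.gradRAu u) u := by
  have h : ∀ (z v w : H) (c : ℝ),
      S.auinner u z (v - c • w) = S.auinner u z v - c * S.auinner u z w := by
    intro z v w c
    simp only [auinner, inner_sub_right, inner_smul_right, map_sub, map_smul, smul_eq_mul]
    ring
  conv_lhs => rw [show S.auinner u (S.gradRAu u) (S.gradRAu u) = S.auinner u (S.gradRAu u)
    (u - ((S.aunorm u (S.Gau u u)) ^ 2)⁻¹ • S.Gau u u) from rfl]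
  rw [h, auinner_Gau, S.P_gradRAu hu, mul_zero, sub_zero]

theorem norm_gradRAu_le {ustar : H} (hgs : S.IsGroundState ustar) {u : H}
    (hu : u ∈ S.Msphere) :
    ‖S.gradRAu u‖ ≤ (1 + S.Vmax * S.C₃ ^ 2
      + S.β * (2 * S.C₁ ^ 4 * (3 * ‖ustar‖ ^ 2 + 3 * ‖u - ustar‖ * ‖ustar‖ + ‖u - ustar‖ ^ 2))
      + |S.auinner ustar ustar ustar| * S.C₃ ^ 2) * ‖u - ustar‖ := by
  have htan := S.P_gradRAu hu
  have hself := S.auinner_gradRAu_self hu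
  have hlow := S.sq_norm_le_auinner u (S.gradRAu u)
  have heig := hgs.auinner_eq (S.gradRAu u)
  rw [hself] at hlow
  generalize S.gradRAu u = R at htan hlow heig ⊢
  generalize S.auinner ustar ustar ustar = l at heig ⊢
  obtain ⟨e, rfl⟩ : ∃ e, u = ustar + e := ⟨u - ustar, by abel⟩
  rw [add_sub_cancel_left]
  rcases (norm_nonneg R).eq_or_lt with hR | hR
  · rw [← hR]
    have := S.Vmax_nonneg
    have := S.β_nonneg
    positivity
  have hP := S.abs_P_le R e
  have hV := S.abs_Vf_le R e
  have hI := real_inner_le_norm R e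
  have q1 := mul_le_mul_of_nonneg_left ((le_abs_self _).trans (S.abs_Q4_le ustar e R)) S.β_nonneg
  have q2 := mul_le_mul_of_nonneg_left ((le_abs_self _).trans (S.abs_Q4_le e ustar R)) S.β_nonneg
  have q3 := mul_le_mul_of_nonneg_left ((le_abs_self _).trans (S.abs_Q4_le e e R)) S.β_nonneg
  have hl : -(l * S.P R e) ≤ |l| * (S.C₃ ^ 2 * ‖R‖ * ‖e‖) :=
    (neg_le_abs _).trans (by rw [abs_mul]; exact mul_le_mul_of_nonneg_left hP (abs_nonneg l))
  rw [auinner, Q4_add_cube, inner_add_right, map_add] at hlow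
  rw [auinner, S.Q4_symm₃ ustar ustar R ustar] at heig
  rw [map_add] at htan
  have hV' := (le_abs_self _).trans hV
  have hPl : l * S.P R ustar = -(l * S.P R e) := by linear_combination l * htan
  refine le_of_mul_le_mul_left (a := ‖R‖) ?_ hR
  linarith

end GPSetting

/-- **Local Lipschitz bound for the Riemannian `a_u`-gradient**
(Lemma `lem:Lg_au`).  Let `u*` be the ground state and `Cu > 0` (the constant
from the energy-decay property of the `a_u`-scheme).  There exists a constant
`Lg > 0` (depending only on `Ω, d, β, V, u*` and `Cu`, hence on `‖u₀‖_{H¹₀}`)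
such that `‖∇^R_{a_u}E(u)‖_{a_{u*}} ≤ Lg ‖u − u*‖_{a_{u*}}` for every `u ∈ M`
with `‖u‖_{H¹₀} ≤ Cu` and `‖u − u*‖_{a_{u*}}` sufficiently small. -/
theorem grad_local_lipschitz_au
    {H : Type*} [NormedAddCommGroup H] [InnerProductSpace ℝ H]
    (S : GPSetting H) (ustar : H) (hgs : S.IsGroundState ustar)
    (Cu : ℝ) (hCu : 0 < Cu) :
    ∃ Lg : ℝ, 0 < Lg ∧ ∃ δ : ℝ, 0 < δ ∧
      ∀ u ∈ S.Msphere, ‖u‖ ≤ Cu → S.aunorm ustar (u - ustar) ≤ δ →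
        S.aunorm ustar (S.gradRAu u) ≤ Lg * S.aunorm ustar (u - ustar) := by
  have hV := S.Vmax_nonneg
  have hβ := S.β_nonneg
  set M := √(1 + S.Vmax * S.C₃ ^ 2 + S.β * (2 * S.C₁ ^ 4 * ‖ustar‖ ^ 2))
  set D := Cu + ‖ustar‖
  set C := 1 + S.Vmax * S.C₃ ^ 2
    + S.β * (2 * S.C₁ ^ 4 * (3 * ‖ustar‖ ^ 2 + 3 * D * ‖ustar‖ + D ^ 2))
    + |S.auinner ustar ustar ustar| * S.C₃ ^ 2 with hC
  have hMpos : 0 < M := by positivity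
  have hCpos : 0 < C := by positivity
  refine ⟨M * C, by positivity, 1, one_pos, fun u hu hu' _ => ?_⟩
  have hD : ‖u - ustar‖ ≤ D := (norm_sub_le _ _).trans (add_le_add_left hu' _)
  calc S.aunorm ustar (S.gradRAu u) ≤ M * ‖S.gradRAu u‖ := S.aunorm_le _ _
    _ ≤ M * (C * ‖u - ustar‖) := by
        gcongr
        refine (S.norm_gradRAu_le hgs hu).trans ?_
        rw [hC]
        gcongr
    _ ≤ M * (C * S.aunorm ustar (u - ustar)) := by
        gcongr
        exact S.norm_le_aunorm _ _
    _ = M * C * S.aunorm ustar (u - ustar) := by ring
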